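/- arXiv:1504.04966 — 3 statements merged into one kernel-verified Lean document; each statement's English description precedes it below -/
import Mathlib

section
/- Parry's criterion: Let a = a_1 a_2 a_3 ⋯ be a sequence of natural numbers which is not the sequence 1,0,0,0,…. Then there exists β > 1 such that a is the β-expansion of 1 if and only if σ^k(a) <lex a for every k ≥ 1; moreover, such a β is uniquely determined by a. -/
/-- The remainders `r_n(t)` of the β-expansion of `t` (0-indexed: `betaRem β t n = r_n(t)`). -/
noncomputable def betaRem (β t : ℝ) : ℕ → ℝ
  | 0 => t
  | n + 1 => Int.fract (β * betaRem β t n)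

/-- `betaDigit β t n` is the digit `x_{n+1}(t)` of the β-expansion of `t` (0-indexed). -/
noncomputable def betaDigit (β t : ℝ) (n : ℕ) : ℕ :=
  (⌊β * betaRem β t n⌋).toNat

/- The generating sequence `g(β)`, 0-indexed: `genSeq β i = g_{i+1}`.
If `e(β)` is eventually zero with last nonzero digit at (0-indexed) position `k`,
then `g(β)` is the periodic sequence of period `k+1` obtained from the initial word
of `e(β)` of length `k+1` by decreasing its last letter by one; otherwise `g(β) = e(β)`. -/
open scoped Classical in
noncomputable def genSeq (β : ℝ) : ℕ → ℕ :=
  if h : ∃ k, betaDigit β 1 k ≠ 0 ∧ ∀ m, k < m → betaDigit β 1 m = 0 then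
    fun i =>
      if i % (Nat.find h + 1) = Nat.find h then betaDigit β 1 (Nat.find h) - 1
      else betaDigit β 1 (i % (Nat.find h + 1))
  else
    betaDigit β 1

/-- Strict lexicographic order on one-sided sequences. -/
def lexLt (x y : ℕ → ℕ) : Prop :=
  ∃ n, (∀ i < n, x i = y i) ∧ x n < y n

/-- Lexicographic order on one-sided sequences. -/
def lexLe (x y : ℕ → ℕ) : Prop :=
  x = y ∨ lexLt x y

/-- Membership in the beta-shift `X_β` (bi-infinite sequences). -/
def memBeta (β : ℝ) (x : ℤ → ℕ) : Prop :=
  ∀ k : ℤ, lexLe (fun n : ℕ => x (k + n)) (genSeq β)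

/-- Membership in the right-ray space `X_β⁺`. -/
def rightRay (β : ℝ) (x : ℕ → ℕ) : Prop :=
  ∀ k : ℕ, lexLe (fun n : ℕ => x (k + n)) (genSeq β)

theorem betaRem_mem_Icc {β t : ℝ} (ht : t ∈ Set.Icc (0 : ℝ) 1) (n : ℕ) :
    betaRem β t n ∈ Set.Icc (0 : ℝ) 1 := by
  cases n with
  | zero => exact ht
  | succ n => exact ⟨Int.fract_nonneg _, (Int.fract_lt_one _).le⟩

theorem betaRem_succ {β t : ℝ} (hβ : 0 ≤ β) (ht : t ∈ Set.Icc (0 : ℝ) 1) (n : ℕ) :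
    betaRem β t (n + 1) = β * betaRem β t n - betaDigit β t n := by
  have hfloor : 0 ≤ ⌊β * betaRem β t n⌋ :=
    Int.floor_nonneg.2 (mul_nonneg hβ (betaRem_mem_Icc ht n).1)
  have hcast : ((betaDigit β t n : ℕ) : ℝ) = ⌊β * betaRem β t n⌋ := by
    exact_mod_cast Int.toNat_of_nonneg hfloor
  rw [hcast]
  rfl

/-- Two orbits driven by the same digits separate geometrically. -/
theorem sub_eq_pow_mul_sub {β : ℝ} {R S : ℕ → ℝ} {a b : ℕ → ℕ}
    (hR : ∀ n, R (n + 1) = β * R n - a n) (hS : ∀ n, S (n + 1) = β * S n - b n) (m : ℕ)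
    (hab : ∀ i < m, b i = a i) : R m - S m = β ^ m * (R 0 - S 0) := by
  induction m with
  | zero => simp
  | succ m ih =>
    rw [hR, hS, hab m m.lt_succ_self, pow_succ']
    linear_combination β * ih (fun i hi => hab i (hi.trans m.lt_succ_self))

theorem nonpos_of_forall_pow_mul_le {β c C : ℝ} (hβ : 1 < β) (h : ∀ n : ℕ, β ^ n * c ≤ C) :
    c ≤ 0 := by
  by_contra! hc
  obtain ⟨n, hn⟩ := pow_unbounded_of_one_lt (C / c) hβ
  exact absurd (h n) (not_le.2 ((div_lt_iff₀ hc).1 hn))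

theorem lexLt_betaDigit_shift {β : ℝ} (hβ : 1 < β) {k : ℕ} (hk : 1 ≤ k) :
    lexLt (fun n => betaDigit β 1 (k + n)) (betaDigit β 1) := by
  classical
  have h1 : (1 : ℝ) ∈ Set.Icc (0 : ℝ) 1 := by simp
  have hrec := betaRem_succ (zero_le_one.trans hβ.le) h1
  have hlt : 0 < 1 - betaRem β 1 k := by
    obtain ⟨j, rfl⟩ := Nat.exists_eq_add_of_le' hk
    exact sub_pos.2 (Int.fract_lt_one _)
  have hsub := sub_eq_pow_mul_sub (S := fun n => betaRem β 1 (k + n))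
    (b := fun n => betaDigit β 1 (k + n)) hrec (fun n => hrec (k + n))
  have hne : ∃ n, betaDigit β 1 (k + n) ≠ betaDigit β 1 n := by
    by_contra! h
    refine absurd (nonpos_of_forall_pow_mul_le (C := 1) hβ fun n => ?_) (not_le.2 hlt)
    have := hsub n fun i _ => h i
    have h2 := (betaRem_mem_Icc (β := β) h1 n).2
    have h3 := (betaRem_mem_Icc (β := β) h1 (k + n)).1
    simp only [add_zero] at this
    change _ = β ^ n * (1 - _) at this
    linarith
  have hagree : ∀ i < Nat.find hne, betaDigit β 1 (k + i) = betaDigit β 1 i :=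
    fun i hi => not_not.1 (Nat.find_min hne hi)
  refine ⟨Nat.find hne, hagree, lt_of_le_of_ne ?_ (Nat.find_spec hne)⟩
  have hmul := hsub _ hagree
  simp only [add_zero] at hmul
  change _ = β ^ Nat.find hne * (1 - _) at hmul
  have hpos : 0 < β ^ Nat.find hne * (1 - betaRem β 1 k) := by positivity
  refine Int.toNat_le_toNat (Int.floor_le_floor ?_)
  exact mul_le_mul_of_nonneg_left (by linarith) (by linarith)

theorem le_of_betaDigit_eq {β₁ β₂ : ℝ} (h₁ : 1 < β₁)
    (h : ∀ n, betaDigit β₁ 1 n = betaDigit β₂ 1 n) : β₂ ≤ β₁ := by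
  by_contra! hlt
  have h1 : (1 : ℝ) ∈ Set.Icc (0 : ℝ) 1 := by simp
  have hsep : ∀ n, β₁ ^ n * (β₂ - β₁) ≤ betaRem β₂ 1 (n + 1) - betaRem β₁ 1 (n + 1) := by
    intro n
    induction n with
    | zero =>
      rw [betaRem_succ (by linarith) h1, betaRem_succ (by linarith) h1, h]
      simp [betaRem]
    | succ n ih =>
      rw [betaRem_succ (by linarith) h1 (n + 1), betaRem_succ (by linarith) h1 (n + 1), h,
        pow_succ']
      have h3 := mul_le_mul_of_nonneg_left ih (zero_le_one.trans h₁.le)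
      have h4 := mul_nonneg (sub_nonneg.2 hlt.le) (betaRem_mem_Icc (β := β₂) h1 (n + 1)).1
      linarith
  have := nonpos_of_forall_pow_mul_le (C := 1) h₁ fun n => (hsep n).trans (by
    linarith [(betaRem_mem_Icc (β := β₂) h1 (n + 1)).2, (betaRem_mem_Icc (β := β₁) h1 (n + 1)).1])
  linarith

section Parry

variable {β C : ℝ} {R : ℕ → ℝ} {a : ℕ → ℕ}

theorem lt_one_of_lexLt_shift (hβ : 1 < β) (h0 : R 0 = 1) (hR : ∀ n, R (n + 1) = β * R n - a n)
    (hpos : ∀ n, 0 ≤ R n) (hC : ∀ n, R n ≤ C)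
    (hlex : ∀ k, 1 ≤ k → lexLt (fun n => a (k + n)) a) {k : ℕ} (hk : 1 ≤ k) : R k < 1 := by
  have hstep : ∀ k, 1 ≤ k → ∃ m, β ^ (m + 1) * (R k - 1) ≤ R (k + m + 1) - 1 - R (m + 1) := by
    intro k hk
    obtain ⟨m, hm, hlt⟩ := hlex k hk
    refine ⟨m, ?_⟩
    have hsub := sub_eq_pow_mul_sub (S := fun n => R (k + n)) hR (fun n => hR (k + n)) m hm
    simp only [add_zero, h0] at hsub
    have hdigit : ((a (k + m) : ℕ) : ℝ) + 1 ≤ a m := by exact_mod_cast hlt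
    rw [hR, hR, pow_succ']
    linarith [congrArg (fun y => β * y) hsub]
  have hbound : ∀ N : ℕ, ∀ k, β ^ N * (R k - 1) ≤ C := by
    intro N
    induction N with
    | zero => intro k; linarith [hC k]
    | succ N ih =>
      intro k
      have hC0 : 0 ≤ C := (hpos 0).trans (hC 0)
      rcases le_or_gt (R k) 1 with h | h
      · exact (mul_nonpos_of_nonneg_of_nonpos (by positivity) (by linarith)).trans hC0
      have hk : 1 ≤ k := by
        rcases Nat.eq_zero_or_pos k with rfl | hk
        · exact absurd h0 h.ne'
        · exact hk
      obtain ⟨m, hm⟩ := hstep k hk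
      have hpow : β ^ 1 ≤ β ^ (m + 1) := pow_le_pow_right₀ hβ.le (by omega)
      have hle : β * (R k - 1) ≤ R (k + m + 1) - 1 := by
        have := mul_le_mul_of_nonneg_right hpow (sub_pos.2 h).le
        rw [pow_one] at this
        linarith [hpos (m + 1)]
      calc β ^ (N + 1) * (R k - 1) = β ^ N * (β * (R k - 1)) := by ring
        _ ≤ β ^ N * (R (k + m + 1) - 1) := by gcongr
        _ ≤ C := ih _
  have hle : ∀ k, R k ≤ 1 := fun k =>
    sub_nonpos.1 (nonpos_of_forall_pow_mul_le hβ fun N => hbound N k)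
  refine lt_of_le_of_ne (hle k) fun heq => ?_
  obtain ⟨m, hm⟩ := hstep k hk
  rw [heq, sub_self, mul_zero] at hm
  have hzero : ∀ j, R (m + 1 + j) = 0 := by
    intro j
    induction j with
    | zero => exact le_antisymm (by linarith [hle (k + m + 1)]) (hpos _)
    | succ j ih =>
      refine le_antisymm ?_ (hpos _)
      rw [← add_assoc, hR, ih]
      simp
  have hk0 := hzero k
  rw [show m + 1 + k = k + m + 1 by omega] at hk0
  linarith [hpos (m + 1)]

theorem betaDigit_eq_of_rec (h0 : R 0 = 1) (hR : ∀ n, R (n + 1) = β * R n - a n)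
    (hpos : ∀ n, 0 ≤ R n) (hlt : ∀ n, R (n + 1) < 1) (n : ℕ) : betaDigit β 1 n = a n := by
  have hfloor : ∀ n, ⌊β * R n⌋ = (a n : ℤ) := fun n =>
    Int.floor_eq_iff.2 ⟨by push_cast; linarith [hR n, hpos (n + 1)],
      by push_cast; linarith [hR n, hlt n]⟩
  have hrem : ∀ n, betaRem β 1 n = R n := by
    intro n
    induction n with
    | zero => exact h0.symm
    | succ n ih => rw [betaRem, ih, Int.fract, hfloor, hR, Int.cast_natCast]
  rw [betaDigit, hrem, hfloor, Int.toNat_natCast]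

end Parry

theorem summable_digits {A : ℕ} {a : ℕ → ℕ} (hA : ∀ i, a i ≤ A) {x : ℝ} (hx0 : 0 ≤ x)
    (hx1 : x < 1) : Summable fun i => (a i : ℝ) * x ^ (i + 1) := by
  refine Summable.of_nonneg_of_le (fun i => by positivity) (fun i => ?_)
    ((summable_geometric_of_lt_one hx0 hx1).mul_left (A : ℝ))
  have : (a i : ℝ) ≤ A := by exact_mod_cast hA i
  exact mul_le_mul this (pow_le_pow_of_le_one hx0 hx1.le i.le_succ) (by positivity) (by positivity)

theorem continuousOn_tsum_digits {A : ℕ} {a : ℕ → ℕ} (hA : ∀ i, a i ≤ A) {y : ℝ} (hy0 : 0 ≤ y)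
    (hy1 : y < 1) : ContinuousOn (fun x : ℝ => ∑' i, (a i : ℝ) * x ^ (i + 1)) (Set.Icc 0 y) := by
  refine continuousOn_tsum (fun i => by fun_prop) (summable_digits hA hy0 hy1) fun i x hx => ?_
  rw [Real.norm_of_nonneg (mul_nonneg (Nat.cast_nonneg _) (pow_nonneg hx.1 _))]
  exact mul_le_mul_of_nonneg_left (pow_le_pow_left₀ hx.1 hx.2 _) (by positivity)

/-- The power series with bounded coefficients `a`, whose sum at `1` exceeds `1`, takes the value
`1` in `(0, 1)`. -/
theorem exists_tsum_digits_eq_one {A : ℕ} {a : ℕ → ℕ} (hA : ∀ i, a i ≤ A) {N : ℕ}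
    (hN : 2 ≤ ∑ i ∈ Finset.range N, a i) :
    ∃ x : ℝ, 0 < x ∧ x < 1 ∧ ∑' i, (a i : ℝ) * x ^ (i + 1) = 1 := by
  have hcont : Continuous fun x : ℝ => ∑ i ∈ Finset.range N, (a i : ℝ) * x ^ (i + 1) := by
    fun_prop
  have hone : (1 : ℝ) < ∑ i ∈ Finset.range N, (a i : ℝ) * 1 ^ (i + 1) := by
    have : (2 : ℝ) ≤ ∑ i ∈ Finset.range N, (a i : ℝ) := by exact_mod_cast hN
    simp only [one_pow, mul_one]
    linarith
  have hnear := (hcont.tendsto 1).eventually (lt_mem_nhds hone)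
  obtain ⟨y, ⟨hy, hy0⟩, hy1⟩ := (((hnear.and (lt_mem_nhds zero_lt_one)).filter_mono
    nhdsWithin_le_nhds).and (self_mem_nhdsWithin (s := Set.Iio (1 : ℝ)))).exists
  have hy1 : y < 1 := hy1
  have hlarge : 1 ≤ ∑' i, (a i : ℝ) * y ^ (i + 1) :=
    hy.le.trans ((summable_digits hA hy0.le hy1).sum_le_tsum _ fun i _ => by positivity)
  have hsmall : ∑' i, (a i : ℝ) * (0 : ℝ) ^ (i + 1) ≤ 1 := by simp
  obtain ⟨x, hx, hxe⟩ := intermediate_value_Icc hy0.le (continuousOn_tsum_digits hA hy0.le hy1)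
    ⟨hsmall, hlarge⟩
  refine ⟨x, lt_of_le_of_ne hx.1 ?_, hx.2.trans_lt hy1, hxe⟩
  rintro rfl
  simp at hxe

theorem tsum_digits_shift_succ {A : ℕ} {a : ℕ → ℕ} (hA : ∀ i, a i ≤ A) {x : ℝ} (hx0 : 0 < x)
    (hx1 : x < 1) (n : ℕ) : ∑' i, (a (n + 1 + i) : ℝ) * x ^ (i + 1) =
      x⁻¹ * ∑' i, (a (n + i) : ℝ) * x ^ (i + 1) - a n := by
  have hs := summable_digits (a := fun i => a (n + i)) (fun i => hA _) hx0.le hx1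
  have heq : ∑' i, (a (n + (i + 1)) : ℝ) * x ^ (i + 1 + 1) =
      x * ∑' i, (a (n + 1 + i) : ℝ) * x ^ (i + 1) := by
    rw [← tsum_mul_left]
    refine tsum_congr fun i => ?_
    rw [show n + (i + 1) = n + 1 + i by omega]
    ring
  rw [hs.tsum_eq_zero_add, heq]
  field_simp
  simp only [add_zero, zero_add, pow_one]
  ring

theorem le_apply_zero_of_lexLt_shift {a : ℕ → ℕ} (hlex : ∀ k, 1 ≤ k → lexLt (fun n => a (k + n)) a)
    (i : ℕ) : a i ≤ a 0 := by
  rcases Nat.eq_zero_or_pos i with rfl | hi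
  · exact le_rfl
  obtain ⟨m, hm, hlt⟩ := hlex i hi
  rcases Nat.eq_zero_or_pos m with rfl | hm0
  · exact hlt.le
  · exact (hm 0 hm0).le

theorem exists_two_le_sum_of_lexLt_shift {a : ℕ → ℕ} (ha : a ≠ fun n => if n = 0 then 1 else 0)
    (hlex : ∀ k, 1 ≤ k → lexLt (fun n => a (k + n)) a) :
    ∃ N, 2 ≤ ∑ i ∈ Finset.range N, a i := by
  have hle := le_apply_zero_of_lexLt_shift hlex
  have hpos : 0 < a 0 := by
    obtain ⟨m, -, hlt⟩ := hlex 1 le_rfl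
    have := hle m
    omega
  by_contra! hsum
  have hzero : a 0 = 1 := by
    have := hsum 1
    simp at this
    omega
  refine ha (funext fun n => ?_)
  rcases Nat.eq_zero_or_pos n with rfl | hn
  · simpa using hzero
  have h := hsum (n + 1)
  rw [Finset.sum_range_succ] at h
  have h0 : a 0 ≤ ∑ i ∈ Finset.range n, a i :=
    Finset.single_le_sum (f := a) (fun i _ => Nat.zero_le _) (Finset.mem_range.2 hn)
  rw [if_neg hn.ne']
  omega

theorem exists_betaDigit_eq_of_lexLt_shift {a : ℕ → ℕ}
    (ha : a ≠ fun n => if n = 0 then 1 else 0)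
    (hlex : ∀ k, 1 ≤ k → lexLt (fun n => a (k + n)) a) :
    ∃ β : ℝ, 1 < β ∧ ∀ n, betaDigit β 1 n = a n := by
  have hA := le_apply_zero_of_lexLt_shift hlex
  obtain ⟨N, hN⟩ := exists_two_le_sum_of_lexLt_shift ha hlex
  obtain ⟨x, hx0, hx1, hx⟩ := exists_tsum_digits_eq_one hA hN
  set R : ℕ → ℝ := fun n => ∑' i, (a (n + i) : ℝ) * x ^ (i + 1) with hRdef
  have h0 : R 0 = 1 := by simpa [hRdef] using hx
  have hR : ∀ n, R (n + 1) = x⁻¹ * R n - a n := tsum_digits_shift_succ hA hx0 hx1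
  have hpos : ∀ n, 0 ≤ R n := fun n => tsum_nonneg fun i => by positivity
  have hC : ∀ n, R n ≤ ∑' i, (a 0 : ℝ) * x ^ (i + 1) := fun n =>
    (summable_digits (a := fun i => a (n + i)) (fun i => hA _) hx0.le hx1).tsum_le_tsum
      (fun i => mul_le_mul_of_nonneg_right (by exact_mod_cast hA _) (by positivity))
      (summable_digits (a := fun _ => a 0) (fun _ => le_rfl) hx0.le hx1)
  have hβ : 1 < x⁻¹ := (one_lt_inv₀ hx0).2 hx1
  exact ⟨x⁻¹, hβ, betaDigit_eq_of_rec h0 hR hpos fun n =>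
    lt_one_of_lexLt_shift hβ h0 hR hpos hC hlex n.succ_pos⟩

/-- Parry's criterion: a sequence `a` of natural numbers, other than
`1,0,0,0,…`, is the β-expansion of `1` for some `β > 1` iff `σ^k(a) <lex a` for all `k ≥ 1`;
moreover such a `β` is unique. -/
theorem statement2 (a : ℕ → ℕ) (ha : a ≠ fun n : ℕ => if n = 0 then 1 else 0) :
    ((∃ β : ℝ, 1 < β ∧ ∀ n : ℕ, betaDigit β 1 n = a n) ↔
        ∀ k : ℕ, 1 ≤ k → lexLt (fun n : ℕ => a (k + n)) a) ∧
      ∀ β₁ β₂ : ℝ, 1 < β₁ → 1 < β₂ → (∀ n : ℕ, betaDigit β₁ 1 n = a n) →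
        (∀ n : ℕ, betaDigit β₂ 1 n = a n) → β₁ = β₂ := by
  refine ⟨⟨?_, exists_betaDigit_eq_of_lexLt_shift ha⟩, fun β₁ β₂ h₁ h₂ e₁ e₂ => ?_⟩
  · rintro ⟨β, hβ, hdigit⟩ k hk
    obtain rfl : betaDigit β 1 = a := funext hdigit
    exact lexLt_betaDigit_shift hβ hk
  · exact le_antisymm (le_of_betaDigit_eq h₂ fun n => (e₂ n).trans (e₁ n).symm)
      (le_of_betaDigit_eq h₁ fun n => (e₁ n).trans (e₂ n).symm)
end

section
/- For every β > 1, the collection of predecessor sets { P^∞(x^+) : x^+ ∈ X_β^+ } is finite if and only if the generating sequence g(β) is eventually periodic. In particular, if g(β) is not eventually periodic, then X_β has infinitely many distinct predecessor sets. -/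
/-- The bi-infinite sequence `z` with `z_{−1−n} = y n` and `z_n = x n` for `n ≥ 0`. -/
def combine (y x : ℕ → ℕ) : ℤ → ℕ :=
  fun i : ℤ => if 0 ≤ i then x i.toNat else y (-(i + 1)).toNat

/-- The predecessor set `P^∞(x⁺)` of a right-ray. -/
def predSet (β : ℝ) (x : ℕ → ℕ) : Set (ℕ → ℕ) :=
  { y | memBeta β (combine y x) }

/-- A sequence is eventually periodic. -/
def EventuallyPeriodic (g : ℕ → ℕ) : Prop :=
  ∃ N p : ℕ, 1 ≤ p ∧ ∀ k, N ≤ k → g (k + p) = g k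

/-- Splitting the lexicographic comparison with `b` after the first `N` letters. -/
lemma lexLe_iff_prefix (a b : ℕ → ℕ) (N : ℕ) :
    lexLe a b ↔ (∃ n < N, (∀ i < n, a i = b i) ∧ a n < b n) ∨
      ((∀ i < N, a i = b i) ∧ lexLe (fun n => a (N + n)) (fun n => b (N + n))) := by
  constructor
  · rintro (rfl | ⟨n, hn, hlt⟩)
    · exact Or.inr ⟨fun _ _ => rfl, Or.inl rfl⟩
    · rcases lt_or_ge n N with h | h
      · exact Or.inl ⟨n, h, hn, hlt⟩
      · obtain ⟨d, rfl⟩ := Nat.exists_eq_add_of_le h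
        exact Or.inr ⟨fun i hi => hn i (by omega), Or.inr ⟨d, fun i hi => hn _ (by omega), hlt⟩⟩
  · rintro (⟨n, -, hn, hlt⟩ | ⟨hN, heq | ⟨d, hd, hlt⟩⟩)
    · exact Or.inr ⟨n, hn, hlt⟩
    · left
      funext i
      rcases lt_or_ge i N with h | h
      · exact hN i h
      · obtain ⟨d, rfl⟩ := Nat.exists_eq_add_of_le h
        exact congrFun heq d
    · refine Or.inr ⟨N + d, fun i hi => ?_, hlt⟩
      rcases lt_or_ge i N with h | h
      · exact hN i h
      · obtain ⟨e, rfl⟩ := Nat.exists_eq_add_of_le h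
        exact hd e (by omega)

lemma lexLe_antisymm {a b : ℕ → ℕ} (hab : lexLe a b) (hba : lexLe b a) : a = b := by
  rcases hab with h | ⟨n, hn, hlt⟩
  · exact h
  rcases hba with h | ⟨m, hm, hlt'⟩
  · exact h.symm
  exfalso
  rcases lt_trichotomy n m with h | rfl | h
  · have := hm n h
    omega
  · omega
  · have := hn m h
    omega

/-- Sequences are in lexicographic order as soon as their first discrepancy is. -/
lemma lexLe_of_forall_le {a b : ℕ → ℕ} (h : ∀ n, (∀ i < n, a i = b i) → a n ≤ b n) :
    lexLe a b := by
  classical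
  by_cases hab : a = b
  · exact Or.inl hab
  · have hex : ∃ n, a n ≠ b n := Function.ne_iff.mp hab
    have hmin : ∀ i < Nat.find hex, a i = b i := fun i hi => not_not.mp (Nat.find_min hex hi)
    exact Or.inr ⟨_, hmin, lt_of_le_of_ne (h _ hmin) (Nat.find_spec hex)⟩

lemma betaRem_nonneg (β : ℝ) {t : ℝ} (ht : 0 ≤ t) (n : ℕ) : 0 ≤ betaRem β t n := by
  cases n with
  | zero => exact ht
  | succ n => exact Int.fract_nonneg _

lemma betaRem_le_one (β : ℝ) {t : ℝ} (ht : t ≤ 1) (n : ℕ) : betaRem β t n ≤ 1 := by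
  cases n with
  | zero => exact ht
  | succ n => exact (Int.fract_lt_one _).le

lemma betaRem_add (β t : ℝ) (k n : ℕ) : betaRem β t (k + n) = betaRem β (betaRem β t k) n := by
  induction n with
  | zero => rfl
  | succ n ih =>
    rw [← Nat.add_assoc, betaRem, betaRem, ih]

lemma betaDigit_add (β t : ℝ) (k n : ℕ) :
    betaDigit β t (k + n) = betaDigit β (betaRem β t k) n := by
  rw [betaDigit, betaDigit, betaRem_add]

lemma betaDigit_le_of_betaRem_le {β s t : ℝ} (hβ : 0 ≤ β) {n : ℕ}
    (h : betaRem β s n ≤ betaRem β t n) : betaDigit β s n ≤ betaDigit β t n :=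
  Int.toNat_le_toNat (Int.floor_le_floor (mul_le_mul_of_nonneg_left h hβ))

lemma betaRem_le_betaRem {β s t : ℝ} (hβ : 0 ≤ β) (hs : 0 ≤ s) (hst : s ≤ t) (n : ℕ)
    (h : ∀ i < n, betaDigit β s i = betaDigit β t i) : betaRem β s n ≤ betaRem β t n := by
  induction n with
  | zero => exact hst
  | succ n ih =>
    have hle := mul_le_mul_of_nonneg_left (ih fun i hi => h i (by omega)) hβ
    have hs' : 0 ≤ ⌊β * betaRem β s n⌋ :=
      Int.floor_nonneg.mpr (mul_nonneg hβ (betaRem_nonneg β hs n))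
    have ht' : 0 ≤ ⌊β * betaRem β t n⌋ :=
      Int.floor_nonneg.mpr (mul_nonneg hβ (betaRem_nonneg β (hs.trans hst) n))
    have hfloor : ⌊β * betaRem β s n⌋ = ⌊β * betaRem β t n⌋ := by
      have := h n (by omega)
      unfold betaDigit at this
      omega
    rw [betaRem, betaRem, Int.fract, Int.fract, hfloor]
    linarith

/-- The β-expansion is monotone in the expanded number. -/
lemma lexLe_betaDigit {β s t : ℝ} (hβ : 0 ≤ β) (hs : 0 ≤ s) (hst : s ≤ t) :
    lexLe (betaDigit β s) (betaDigit β t) :=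
  lexLe_of_forall_le fun n h => betaDigit_le_of_betaRem_le hβ (betaRem_le_betaRem hβ hs hst n h)

/-- Every shift of the β-expansion of `1` is lexicographically at most that expansion. -/
lemma lexLe_betaDigit_one_shift {β : ℝ} (hβ : 0 ≤ β) (k : ℕ) :
    lexLe (fun n => betaDigit β 1 (k + n)) (betaDigit β 1) := by
  have hk : (fun n => betaDigit β 1 (k + n)) = betaDigit β (betaRem β 1 k) :=
    funext (betaDigit_add β 1 k)
  rw [hk]
  exact lexLe_betaDigit hβ (betaRem_nonneg β zero_le_one k) (betaRem_le_one β le_rfl k)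

lemma betaDigit_one_zero_pos {β : ℝ} (hβ : 1 < β) : 0 < betaDigit β 1 0 := by
  have : 1 ≤ ⌊β * betaRem β 1 0⌋ := Int.le_floor.mpr (by simpa [betaRem] using hβ.le)
  unfold betaDigit
  omega

lemma genSeq_eq_betaDigit {β : ℝ} (h : ¬ EventuallyPeriodic (genSeq β)) :
    genSeq β = betaDigit β 1 := by
  by_cases hz : ∃ k, betaDigit β 1 k ≠ 0 ∧ ∀ m, k < m → betaDigit β 1 m = 0
  · classical
    exact absurd ⟨0, Nat.find hz + 1, by omega, fun k _ => by simp [genSeq, dif_pos hz]⟩ h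
  · exact dif_neg hz

/-- The predecessor set of a right-ray `x` depends on `x` only through the shifts of `g(β)` that
dominate `x`. -/
lemma mem_predSet_iff {β : ℝ} {x : ℕ → ℕ} (hx : rightRay β x) (y : ℕ → ℕ) :
    y ∈ predSet β x ↔ ∀ m, (∃ n < m + 1, (∀ i < n, y (m - i) = genSeq β i) ∧
        y (m - n) < genSeq β n) ∨
      ((∀ i < m + 1, y (m - i) = genSeq β i) ∧
        lexLe x (fun n => genSeq β (m + 1 + n))) := by
  have hleft : ∀ m i : ℕ, i < m + 1 → combine y x (-((m : ℤ) + 1) + i) = y (m - i) := by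
    intro m i hi
    rw [combine, if_neg (by omega)]
    congr 1
    omega
  have hright : ∀ m n : ℕ, combine y x (-((m : ℤ) + 1) + (m + 1 + n : ℕ)) = x n := by
    intro m n
    rw [combine, if_pos (by omega)]
    congr 1
    omega
  have key : ∀ m : ℕ, lexLe (fun n : ℕ => combine y x (-((m : ℤ) + 1) + n)) (genSeq β) ↔
      (∃ n < m + 1, (∀ i < n, y (m - i) = genSeq β i) ∧ y (m - n) < genSeq β n) ∨
      ((∀ i < m + 1, y (m - i) = genSeq β i) ∧
        lexLe x (fun n => genSeq β (m + 1 + n))) := by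
    intro m
    rw [lexLe_iff_prefix _ _ (m + 1)]
    simp only [hright]
    refine or_congr (exists_congr fun n => and_congr_right fun hn => ?_) (and_congr_left fun _ => ?_)
    · rw [hleft m n hn]
      exact and_congr_left fun _ =>
        forall₂_congr fun i hi => by rw [hleft m i (hi.trans hn)]
    · exact forall₂_congr fun i hi => by rw [hleft m i hi]
  constructor
  · exact fun hy m => (key m).mp (hy _)
  · intro h k
    rcases lt_or_ge k 0 with hk | hk
    · obtain ⟨m, rfl⟩ : ∃ m : ℕ, k = -((m : ℤ) + 1) := ⟨(-(k + 1)).toNat, by omega⟩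
      exact (key m).mpr (h m)
    · obtain ⟨m, rfl⟩ := Int.eq_ofNat_of_zero_le hk
      have hm : (fun n : ℕ => combine y x ((m : ℤ) + n)) = fun n => x (m + n) := by
        funext n
        rw [combine, if_pos (by omega)]
        congr 1
      rw [hm]
      exact hx m

/-- An eventually periodic sequence has only finitely many shifts. -/
lemma EventuallyPeriodic.finite_range_shift {g : ℕ → ℕ} (h : EventuallyPeriodic g) :
    (Set.range fun k n => g (k + n)).Finite := by
  obtain ⟨N, p, hp, hper⟩ := h
  refine ((Set.finite_Iio (N + p)).image fun k n => g (k + n)).subset ?_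
  rintro _ ⟨k, rfl⟩
  induction k using Nat.strong_induction_on with
  | _ k ih =>
    rcases lt_or_ge k (N + p) with hk | hk
    · exact ⟨k, hk, rfl⟩
    · convert ih (k - p) (by omega) using 1
      funext n
      change g (k + n) = g (k - p + n)
      rw [← hper (k - p + n) (by omega)]
      congr 1
      omega

/-- The shifts of a sequence that is not eventually periodic are pairwise distinct. -/
lemma injective_shift_of_not_eventuallyPeriodic {g : ℕ → ℕ} (h : ¬ EventuallyPeriodic g) :
    Function.Injective fun k n => g (k + n) := by
  have aux : ∀ k l, k < l → (fun n => g (k + n)) ≠ fun n => g (l + n) := by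
    refine fun k l hkl heq => h ⟨k, l - k, by omega, fun j hj => ?_⟩
    have : g (k + (j - k)) = g (l + (j - k)) := congrFun heq (j - k)
    rw [show j + (l - k) = l + (j - k) by omega, ← this]
    congr 1
    omega
  intro k l hkl
  rcases lt_trichotomy k l with hlt | heq | hlt
  · exact absurd hkl (aux k l hlt)
  · exact heq
  · exact absurd hkl.symm (aux l k hlt)

lemma finite_predSets {β : ℝ} (h : EventuallyPeriodic (genSeq β)) :
    { P : Set (ℕ → ℕ) | ∃ x : ℕ → ℕ, rightRay β x ∧ P = predSet β x }.Finite := by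
  refine (h.finite_range_shift.powerset.image fun S => { y : ℕ → ℕ |
    ∀ m, (∃ n < m + 1, (∀ i < n, y (m - i) = genSeq β i) ∧ y (m - n) < genSeq β n) ∨
      ((∀ i < m + 1, y (m - i) = genSeq β i) ∧ (fun n => genSeq β (m + 1 + n)) ∈ S) }).subset ?_
  rintro _ ⟨x, hx, rfl⟩
  refine ⟨{ v ∈ Set.range fun k n => genSeq β (k + n) | lexLe x v }, fun v hv => hv.1, ?_⟩
  ext y
  rw [mem_predSet_iff hx]
  refine forall_congr' fun m => or_congr_right (and_congr_right fun _ => ?_)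
  exact ⟨fun hv => hv.2, fun hv => ⟨⟨m + 1, rfl⟩, hv⟩⟩

lemma rightRay_shift_genSeq {β : ℝ}
    (hadm : ∀ k, lexLe (fun n => genSeq β (k + n)) (genSeq β)) (k : ℕ) :
    rightRay β (fun n => genSeq β (k + n)) := by
  intro j
  simpa only [Nat.add_assoc] using hadm (k + j)

/-- If `P^∞(σ^{k+1} g) ⊆ P^∞(x)`, then `x ≤ σ^{k+1} g`: prolong `σ^{k+1} g` to `0^∞ g`. -/
lemma lexLe_shift_of_predSet_subset {β : ℝ}
    (hadm : ∀ k, lexLe (fun n => genSeq β (k + n)) (genSeq β)) (hpos : 0 < genSeq β 0)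
    {x : ℕ → ℕ} (hx : rightRay β x) {k : ℕ}
    (hsub : predSet β (fun n => genSeq β (k + 1 + n)) ⊆ predSet β x) :
    lexLe x (fun n => genSeq β (k + 1 + n)) := by
  let y : ℕ → ℕ := fun i => if i ≤ k then genSeq β (k - i) else 0
  have hy : y ∈ predSet β (fun n => genSeq β (k + 1 + n)) := by
    rw [mem_predSet_iff (rightRay_shift_genSeq hadm (k + 1))]
    intro m
    rcases le_or_gt m k with hm | hm
    · have hval : ∀ i < m + 1, y (m - i) = genSeq β (k - m + i) := by
        intro i hi
        simp only [y]
        rw [if_pos (by omega)]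
        congr 1
        omega
      refine ((lexLe_iff_prefix _ _ (m + 1)).mp (hadm (k - m))).imp ?_ ?_
      · rintro ⟨n, hn, heq, hlt⟩
        exact ⟨n, hn, fun i hi => (hval i (by omega)).trans (heq i hi), (hval n hn).trans_lt hlt⟩
      · rintro ⟨heq, hle⟩
        refine ⟨fun i hi => (hval i hi).trans (heq i hi), ?_⟩
        convert hle using 3
        omega
    · exact Or.inl ⟨0, by omega, by simp, by simpa [y, hm.not_ge] using hpos⟩
  have hval : ∀ i < k + 1, y (k - i) = genSeq β i := by
    intro i hi
    simp only [y]
    rw [if_pos (by omega)]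
    congr 1
    omega
  rcases (mem_predSet_iff hx y).mp (hsub hy) k with ⟨n, hn, -, hlt⟩ | ⟨-, hle⟩
  · exact absurd (hval n hn) hlt.ne
  · exact hle

lemma infinite_predSets {β : ℝ} (hβ : 1 < β) (h : ¬ EventuallyPeriodic (genSeq β)) :
    { P : Set (ℕ → ℕ) | ∃ x : ℕ → ℕ, rightRay β x ∧ P = predSet β x }.Infinite := by
  have hadm : ∀ k, lexLe (fun n => genSeq β (k + n)) (genSeq β) := by
    rw [genSeq_eq_betaDigit h]
    exact lexLe_betaDigit_one_shift (by linarith)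
  have hpos : 0 < genSeq β 0 := by
    rw [genSeq_eq_betaDigit h]
    exact betaDigit_one_zero_pos hβ
  refine Set.infinite_of_injective_forall_mem
    (f := fun k => predSet β (fun n => genSeq β (k + 1 + n))) (fun k l hkl => ?_)
    fun k => ⟨_, rightRay_shift_genSeq hadm (k + 1), rfl⟩
  have hk := rightRay_shift_genSeq hadm (k + 1)
  have hl := rightRay_shift_genSeq hadm (l + 1)
  exact Nat.succ_injective <| injective_shift_of_not_eventuallyPeriodic h <| lexLe_antisymm
    (lexLe_shift_of_predSet_subset hadm hpos hk hkl.ge)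
    (lexLe_shift_of_predSet_subset hadm hpos hl hkl.le)

/-- the collection of predecessor sets of `X_β` is finite iff `g(β)` is
eventually periodic; in particular if `g(β)` is not eventually periodic, `X_β` has
infinitely many distinct predecessor sets. -/
theorem statement5 (β : ℝ) (hβ : 1 < β) :
    ({ P : Set (ℕ → ℕ) | ∃ x : ℕ → ℕ, rightRay β x ∧ P = predSet β x }.Finite ↔
        EventuallyPeriodic (genSeq β)) ∧
      (¬ EventuallyPeriodic (genSeq β) →
        { P : Set (ℕ → ℕ) | ∃ x : ℕ → ℕ, rightRay β x ∧ P = predSet β x }.Infinite) := by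
  refine ⟨⟨fun hfin => ?_, finite_predSets⟩, infinite_predSets hβ⟩
  by_contra h
  exact infinite_predSets hβ h hfin
end

section
/- The Fischer graph presents the beta-shift: let β > 1 have eventually periodic generating sequence g(β), with n ≥ 0 and p ≥ 1 minimal such that g(β) = g_1 ⋯ g_n (g_{n+1} ⋯ g_{n+p})^∞. Then a sequence x : ℤ → ℕ belongs to X_β if and only if x admits a presentation in the Fischer graph F_β. -/
/-- The edge relation of the Fischer graph `F_β` of a sofic beta-shift whose generating
sequence is `g = g_1 g_2 ⋯` (0-indexed: `g i = g_{i+1}`) with minimal decomposition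
`g(β) = g_1 ⋯ g_n (g_{n+1} ⋯ g_{n+p})^∞`.  `fischerEdge g n p a i j` says that there is
an edge labeled `a` from vertex `i` to vertex `j` (vertices are `1, …, n+p`). -/
def fischerEdge (g : ℕ → ℕ) (n p : ℕ) (a i j : ℕ) : Prop :=
  1 ≤ i ∧ i ≤ n + p ∧
    ((a < g (i - 1) ∧ j = 1) ∨
     (a = g (i - 1) ∧ i < n + p ∧ j = i + 1) ∨
     (a = g (i - 1) ∧ i = n + p ∧ j = n + 1))

theorem lexLe_iff {x y : ℕ → ℕ} :
    lexLe x y ↔ ∀ N, (∀ i < N, x i = y i) → x N ≤ y N := by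
  classical
  constructor
  · rintro (rfl | ⟨m, hm, hlt⟩) N hN
    · exact le_rfl
    · rcases lt_trichotomy N m with h | rfl | h
      · exact (hm N h).le
      · exact hlt.le
      · exact absurd (hN m h) hlt.ne
  · intro h
    by_cases hxy : x = y
    · exact Or.inl hxy
    · have hex : ∃ i, x i ≠ y i := Function.ne_iff.mp hxy
      have hbelow : ∀ i < Nat.find hex, x i = y i := fun i hi =>
        not_not.mp (Nat.find_min hex hi)
      exact Or.inr ⟨Nat.find hex, hbelow,
        lt_of_le_of_ne (h _ hbelow) (Nat.find_spec hex)⟩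

theorem lexLe_trans {x y z : ℕ → ℕ} (hxy : lexLe x y) (hyz : lexLe y z) : lexLe x z := by
  rcases hxy with rfl | ⟨m, hm, hlt⟩
  · exact hyz
  rcases hyz with rfl | ⟨k, hk, hlt'⟩
  · exact Or.inr ⟨m, hm, hlt⟩
  refine Or.inr ⟨min m k, fun i hi => ?_, ?_⟩
  · rw [hm i (by omega), hk i (by omega)]
  · rcases lt_trichotomy m k with h | rfl | h
    · rw [min_eq_left h.le, ← hk m h]; exact hlt
    · rw [min_self]; exact hlt.trans hlt'
    · rw [min_eq_right h.le, hm k h]; exact hlt'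

/-- The remainders of the quasi-greedy β-expansion of `t`. -/
noncomputable def quasiRem (β t : ℝ) : ℕ → ℝ
  | 0 => t
  | n + 1 => β * quasiRem β t n - (⌈β * quasiRem β t n⌉ - 1)

/-- The digits of the quasi-greedy β-expansion of `t`. -/
noncomputable def quasiDigit (β t : ℝ) (n : ℕ) : ℕ :=
  (⌈β * quasiRem β t n⌉ - 1).toNat

theorem quasiRem_mem_Ioc {β t : ℝ} (ht : t ∈ Set.Ioc (0 : ℝ) 1) (n : ℕ) :
    quasiRem β t n ∈ Set.Ioc (0 : ℝ) 1 := by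
  cases n with
  | zero => exact ht
  | succ n =>
    have h1 := Int.le_ceil (β * quasiRem β t n)
    have h2 := Int.ceil_lt_add_one (β * quasiRem β t n)
    constructor <;> simp only [quasiRem] <;> linarith

/-- The quasi-greedy expansion of `1` dominates all of its shifts. -/
theorem quasiDigit_shift_le {β : ℝ} (hβ : 0 < β) (k : ℕ) :
    lexLe (fun n => quasiDigit β 1 (k + n)) (quasiDigit β 1) := by
  have hone : (1 : ℝ) ∈ Set.Ioc (0 : ℝ) 1 := by simp
  have hpos (m : ℕ) : 1 ≤ ⌈β * quasiRem β 1 m⌉ :=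
    Int.one_le_ceil_iff.mpr (mul_pos hβ (quasiRem_mem_Ioc hone m).1)
  have hrem (N : ℕ) (h : ∀ i < N, quasiDigit β 1 (k + i) = quasiDigit β 1 i) :
      quasiRem β 1 (k + N) ≤ quasiRem β 1 N := by
    induction N with
    | zero => exact (quasiRem_mem_Ioc hone k).2
    | succ N ih =>
      have hle := mul_le_mul_of_nonneg_left (ih fun i hi => h i (hi.trans N.lt_succ_self)) hβ.le
      have hdig := h N N.lt_succ_self
      have hceil : ⌈β * quasiRem β 1 (k + N)⌉ = ⌈β * quasiRem β 1 N⌉ := by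
        have h1 := hpos (k + N)
        have h2 := hpos N
        simp only [quasiDigit] at hdig
        omega
      rw [← Nat.add_assoc]
      simp only [quasiRem, hceil]
      linarith
  refine lexLe_iff.mpr fun N h => Int.toNat_le_toNat ?_
  have := Int.ceil_le_ceil (mul_le_mul_of_nonneg_left (hrem N h) hβ.le)
  omega

theorem betaRem_eq_zero_of_le {β t : ℝ} {m : ℕ} (h : betaRem β t m = 0) {n : ℕ} (hmn : m ≤ n) :
    betaRem β t n = 0 := by
  induction n, hmn using Nat.le_induction with
  | base => exact h
  | succ n _ ih => simp [betaRem, ih]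

theorem betaDigit_eq_zero_of_le {β t : ℝ} {m : ℕ} (h : betaRem β t m = 0) {n : ℕ}
    (hmn : m ≤ n) : betaDigit β t n = 0 := by
  simp [betaDigit, betaRem_eq_zero_of_le h hmn]

theorem betaDigit_cast {β t : ℝ} (hβ : 0 ≤ β) (ht : t ∈ Set.Icc (0 : ℝ) 1) (n : ℕ) :
    ((betaDigit β t n : ℕ) : ℤ) = ⌊β * betaRem β t n⌋ :=
  Int.toNat_of_nonneg (Int.floor_nonneg.mpr (mul_nonneg hβ (betaRem_mem_Icc ht n).1))

theorem ceil_eq_floor_add_one {a : ℝ} (h : Int.fract a ≠ 0) : ⌈a⌉ = ⌊a⌋ + 1 := by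
  rw [Int.ceil_eq_iff]
  have h1 := Int.floor_add_fract a
  have h2 := (Int.fract_nonneg a).lt_of_ne' h
  have h3 := Int.lt_floor_add_one a
  push_cast
  constructor <;> linarith

theorem quasiRem_eq_betaRem {β t : ℝ} {m : ℕ} (h : ∀ i < m, betaRem β t (i + 1) ≠ 0) :
    quasiRem β t m = betaRem β t m := by
  induction m with
  | zero => rfl
  | succ m ih =>
    have hne : Int.fract (β * betaRem β t m) ≠ 0 := h m m.lt_succ_self
    rw [quasiRem, ih fun i hi => h i (hi.trans m.lt_succ_self), ceil_eq_floor_add_one hne,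
      betaRem, Int.fract]
    push_cast
    ring

theorem quasiDigit_eq_betaDigit {β t : ℝ} {m : ℕ} (h : ∀ i ≤ m, betaRem β t (i + 1) ≠ 0) :
    quasiDigit β t m = betaDigit β t m := by
  have hne : Int.fract (β * betaRem β t m) ≠ 0 := h m le_rfl
  rw [quasiDigit, quasiRem_eq_betaRem fun i hi => h i hi.le, ceil_eq_floor_add_one hne,
    betaDigit, add_sub_cancel_right]

theorem betaRem_eq_zero_of_betaDigit_eq_zero {β t : ℝ} (hβ : 1 < β)
    (ht : t ∈ Set.Icc (0 : ℝ) 1) {m : ℕ} (h : ∀ n, m ≤ n → betaDigit β t n = 0) :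
    betaRem β t m = 0 := by
  have hpow (j : ℕ) : betaRem β t (m + j) = β ^ j * betaRem β t m := by
    induction j with
    | zero => simp
    | succ j ih =>
      have hfl := betaDigit_cast (zero_le_one.trans hβ.le) ht (m + j)
      rw [h _ (Nat.le_add_right m j)] at hfl
      rw [← Nat.add_assoc, betaRem, Int.fract, ← hfl, ih]
      push_cast
      ring
  by_contra hne
  have hpos := (betaRem_mem_Icc ht m (β := β)).1.lt_of_ne' hne
  obtain ⟨j, hj⟩ := pow_unbounded_of_one_lt (betaRem β t m)⁻¹ hβ
  have hlt : 1 < β ^ j * betaRem β t m := by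
    rwa [inv_lt_iff_one_lt_mul₀' hpos, mul_comm] at hj
  exact absurd (betaRem_mem_Icc ht (m + j) (β := β)).2 (by rw [hpow]; exact hlt.not_ge)

theorem genSeq_eq_quasiDigit {β : ℝ} (hβ : 1 < β) : genSeq β = quasiDigit β 1 := by
  classical
  have hone : (1 : ℝ) ∈ Set.Icc (0 : ℝ) 1 := by simp
  have hβ0 : 0 ≤ β := zero_le_one.trans hβ.le
  unfold genSeq
  split_ifs with h
  · set K := Nat.find h
    obtain ⟨hne, hzero⟩ : betaDigit β 1 K ≠ 0 ∧ ∀ m, K < m → betaDigit β 1 m = 0 :=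
      Nat.find_spec h
    have hrem (i : ℕ) (hi : i < K) : betaRem β 1 (i + 1) ≠ 0 := fun h0 =>
      hne (betaDigit_eq_zero_of_le h0 hi)
    have hremK : betaRem β 1 (K + 1) = 0 :=
      betaRem_eq_zero_of_betaDigit_eq_zero hβ hone hzero
    have hmul : β * quasiRem β 1 K = ((betaDigit β 1 K : ℤ) : ℝ) := by
      rw [quasiRem_eq_betaRem hrem, betaDigit_cast hβ0 hone]
      have hfract : Int.fract (β * betaRem β 1 K) = 0 := hremK
      have := Int.floor_add_fract (β * betaRem β 1 K)
      linarith
    have hqK : quasiDigit β 1 K = betaDigit β 1 K - 1 := by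
      rw [quasiDigit, hmul, Int.ceil_intCast]
      omega
    have hperiod : quasiRem β 1 (K + 1) = 1 := by
      rw [quasiRem, hmul, Int.ceil_intCast]
      ring
    have hremper (i : ℕ) : quasiRem β 1 (i + (K + 1)) = quasiRem β 1 i := by
      induction i with
      | zero => rw [Nat.zero_add, hperiod, quasiRem]
      | succ i ih => rw [Nat.add_right_comm, quasiRem, ih, quasiRem]
    have hdigper : Function.Periodic (quasiDigit β 1) (K + 1) := fun i => by
      simp only [quasiDigit, hremper]
    funext i
    rw [← hdigper.map_mod_nat i]
    have hlt : i % (K + 1) < K + 1 := Nat.mod_lt _ K.succ_pos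
    by_cases hi : i % (K + 1) = K
    · rw [if_pos hi, hi, hqK]
    · rw [if_neg hi]
      exact (quasiDigit_eq_betaDigit fun j hj => hrem j (by omega)).symm
  · have hrem (m : ℕ) : betaRem β 1 m ≠ 0 := by
      intro h0
      have h00 : betaDigit β 1 0 ≠ 0 := by
        have h1 : (1 : ℤ) ≤ ⌊β * betaRem β 1 0⌋ :=
          Int.le_floor.mpr (by simpa [betaRem] using hβ.le)
        have := betaDigit_cast hβ0 hone 0
        omega
      let P := fun k => betaDigit β 1 k ≠ 0
      refine h ⟨Nat.findGreatest P m, Nat.findGreatest_spec (P := P) (Nat.zero_le m) h00,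
        fun j hj => ?_⟩
      rcases le_total j m with hjm | hjm
      · exact not_not.mp (Nat.findGreatest_is_greatest hj hjm)
      · exact betaDigit_eq_zero_of_le h0 hjm
    funext i
    exact (quasiDigit_eq_betaDigit fun j _ => hrem (j + 1)).symm

/-- The generating sequence dominates all of its shifts. -/
theorem genSeq_shift_le {β : ℝ} (hβ : 1 < β) (k : ℕ) :
    lexLe (fun n => genSeq β (k + n)) (genSeq β) := by
  rw [genSeq_eq_quasiDigit hβ]
  exact quasiDigit_shift_le (zero_lt_one.trans hβ) k

/-- Reduction of an index to the preperiod `n` and a single period `p`. -/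
def reduceIndex (n p l : ℕ) : ℕ := if l < n then l else n + (l - n) % p

theorem reduceIndex_lt {n p : ℕ} (hp : 1 ≤ p) (l : ℕ) : reduceIndex n p l < n + p := by
  unfold reduceIndex
  split_ifs
  · omega
  · exact Nat.add_lt_add_left (Nat.mod_lt _ hp) n

theorem reduceIndex_succ {n p : ℕ} (hp : 1 ≤ p) (l : ℕ) :
    reduceIndex n p (l + 1) =
      if reduceIndex n p l + 1 = n + p then n else reduceIndex n p l + 1 := by
  rcases lt_trichotomy (l + 1) n with h | h | h
  · simp only [reduceIndex, if_pos h, if_pos (show l < n by omega)]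
    rw [if_neg (by omega)]
  · subst h
    simp only [reduceIndex, lt_irrefl, if_false, if_pos l.lt_succ_self, Nat.sub_self,
      Nat.zero_mod, Nat.add_zero]
    rw [if_neg (by omega)]
  · have h1 : ¬ l + 1 < n := by omega
    have h2 : ¬ l < n := by omega
    simp only [reduceIndex, if_neg h1, if_neg h2]
    have hmod := Nat.mod_lt (l - n) hp
    rw [show l + 1 - n = (l - n) + 1 by omega, Nat.add_mod_eq_ite]
    rcases hp.eq_or_lt with rfl | hp'
    · simp [Nat.mod_one]
    · rw [Nat.mod_eq_of_lt hp']
      split_ifs <;> omega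

theorem apply_reduceIndex {g : ℕ → ℕ} {n p : ℕ} (hper : ∀ k, n ≤ k → g (k + p) = g k) (l : ℕ) :
    g (reduceIndex n p l) = g l := by
  unfold reduceIndex
  split_ifs with h
  · rfl
  · have hp : Function.Periodic (fun i => g (n + i)) p := fun i => by
      simpa [Nat.add_assoc] using hper (n + i) (Nat.le_add_right n i)
    have hmod : g (n + (l - n) % p) = g (n + (l - n)) := hp.map_mod_nat (l - n)
    rw [hmod, Nat.add_sub_of_le (not_lt.mp h)]

/-- The right ray read along a path starting at vertex `i` is at most the shift of `g` by
`i - 1`. -/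
theorem lexLe_of_fischerPath {g : ℕ → ℕ} {n p : ℕ} (hper : ∀ k, n ≤ k → g (k + p) = g k)
    {y v : ℕ → ℕ} (hv : ∀ i, fischerEdge g n p (y i) (v i) (v (i + 1))) :
    lexLe y (fun i => g (v 0 - 1 + i)) := by
  have hstate (N : ℕ) (h : ∀ i < N, y i = g (v 0 - 1 + i)) :
      ∀ j, g (v N - 1 + j) = g (v 0 - 1 + N + j) := by
    induction N with
    | zero => intro j; rfl
    | succ N ih =>
      intro j
      have ih := ih fun i hi => h i (hi.trans N.lt_succ_self)
      have hN : y N = g (v N - 1) := (h N N.lt_succ_self).trans (ih 0).symm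
      rw [← Nat.add_assoc, Nat.add_assoc _ 1 j, ← ih (1 + j)]
      obtain ⟨hpos, _, ⟨hlt, _⟩ | ⟨_, _, hnext⟩ | ⟨_, hlast, hnext⟩⟩ := hv N
      · exact absurd hN hlt.ne
      · rw [hnext]
        congr 1
        omega
      · rw [hnext, hlast, Nat.add_sub_cancel, ← hper (n + j) (Nat.le_add_right n j)]
        congr 1
        omega
  refine lexLe_iff.mpr fun N h => ?_
  have hN : g (v N - 1) = g (v 0 - 1 + N) := hstate N h 0
  rw [← hN]
  obtain ⟨_, _, ⟨hlt, _⟩ | ⟨heq, _⟩ | ⟨heq, _⟩⟩ := hv N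
  · exact hlt.le
  · exact heq.le
  · exact heq.le

/-- The length of the prefix of `g` matched when reading `y`, resetting at each letter smaller
than the expected one. -/
def matchLength (g y : ℕ → ℕ) : ℕ → ℕ
  | 0 => 0
  | t + 1 => if y t < g (matchLength g y t) then 0 else matchLength g y t + 1

theorem matchLength_spec {g y : ℕ → ℕ} (hy : ∀ k, lexLe (fun i => y (k + i)) g) (t : ℕ) :
    (∃ k, k + matchLength g y t = t ∧ ∀ i < matchLength g y t, y (k + i) = g i) ∧
      y t ≤ g (matchLength g y t) := by
  have hle (t : ℕ)
      (h : ∃ k, k + matchLength g y t = t ∧ ∀ i < matchLength g y t, y (k + i) = g i) :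
      y t ≤ g (matchLength g y t) := by
    obtain ⟨k, hk, h⟩ := h
    simpa only [hk] using lexLe_iff.mp (hy k) _ h
  have hmatch : ∃ k, k + matchLength g y t = t ∧ ∀ i < matchLength g y t, y (k + i) = g i := by
    induction t with
    | zero => exact ⟨0, rfl, fun i hi => absurd hi i.not_lt_zero⟩
    | succ t ih =>
      by_cases hlt : y t < g (matchLength g y t)
      · simp only [matchLength, if_pos hlt]
        exact ⟨t + 1, rfl, fun i hi => absurd hi i.not_lt_zero⟩
      · simp only [matchLength, if_neg hlt]
        have heq := le_antisymm (hle t ih) (not_lt.mp hlt)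
        obtain ⟨k, hk, h⟩ := ih
        refine ⟨k, by omega, fun i hi => ?_⟩
        rcases Nat.lt_succ_iff_lt_or_eq.mp hi with hi | rfl
        · exact h i hi
        · rw [hk, heq]
  exact ⟨hmatch, hle t hmatch⟩

/-- A right ray all of whose shifts are at most `g` is read along a path of the Fischer graph. -/
theorem exists_fischerPath {g : ℕ → ℕ} {n p : ℕ} (hp : 1 ≤ p)
    (hper : ∀ k, n ≤ k → g (k + p) = g k) {y : ℕ → ℕ}
    (hy : ∀ k, lexLe (fun i => y (k + i)) g) :
    ∃ v : ℕ → ℕ, ∀ i, fischerEdge g n p (y i) (v i) (v (i + 1)) := by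
  refine ⟨fun t => reduceIndex n p (matchLength g y t) + 1, fun t => ?_⟩
  have hlt := reduceIndex_lt (n := n) hp (matchLength g y t)
  refine ⟨Nat.le_add_left 1 _, hlt, ?_⟩
  simp only [Nat.add_sub_cancel, apply_reduceIndex hper]
  rcases (matchLength_spec hy t).2.lt_or_eq with h | h
  · refine Or.inl ⟨h, ?_⟩
    simp [matchLength, h, reduceIndex]
  · refine Or.inr ?_
    simp only [matchLength, if_neg h.not_lt, reduceIndex_succ hp]
    split_ifs with hend
    · exact Or.inr ⟨h, hend, rfl⟩
    · exact Or.inl ⟨h, by omega, rfl⟩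

/-- If every truncation of `x` to `[-N, ∞)` is read along a path of the Fischer graph, then so
is `x`, by compactness. -/
theorem exists_fischerPath_int {g : ℕ → ℕ} {n p : ℕ} {x : ℤ → ℕ}
    (h : ∀ N : ℕ, ∃ v : ℕ → ℕ, ∀ i : ℕ,
      fischerEdge g n p (x (-N + i)) (v i) (v (i + 1))) :
    ∃ v : ℤ → ℕ, ∀ i : ℤ, fischerEdge g n p (x i) (v i) (v (i + 1)) := by
  choose w hw using h
  have hedge (i : ℤ) : ∀ᶠ N in (Filter.hyperfilter ℕ : Filter ℕ),
      fischerEdge g n p (x i) (w N (i + N).toNat) (w N (i + 1 + N).toNat) := by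
    refine Filter.Eventually.filter_mono Nat.hyperfilter_le_atTop ?_
    filter_upwards [Filter.eventually_ge_atTop (-i).toNat] with N hN
    have hnonneg : 0 ≤ i + N := by omega
    have := hw N (i + N).toNat
    rwa [Int.toNat_of_nonneg hnonneg, show -(N : ℤ) + (i + N) = i by ring,
      show (i + N).toNat + 1 = (i + 1 + N).toNat by omega] at this
  have hlim (i : ℤ) : ∃ c, ∀ᶠ N in (Filter.hyperfilter ℕ : Filter ℕ),
      w N (i + N).toNat = c := by
    have hfin := (Ultrafilter.eventually_exists_mem_iff (f := Filter.hyperfilter ℕ)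
      (P := fun c N => w N (i + N).toNat = c) (Set.finite_Icc 1 (n + p))).mp
      ((hedge i).mono fun N hN => ⟨_, ⟨hN.1, hN.2.1⟩, rfl⟩)
    obtain ⟨c, -, hc⟩ := hfin
    exact ⟨c, hc⟩
  choose v hv using hlim
  refine ⟨v, fun i => ?_⟩
  obtain ⟨N, hN, h0, h1⟩ := ((hedge i).and ((hv i).and (hv (i + 1)))).exists
  rwa [h0, h1] at hN

/-- the Fischer graph presents the beta-shift.  If `g(β)` is eventually
periodic with minimal `n ≥ 0`, `p ≥ 1` such that `g(β) = g_1 ⋯ g_n (g_{n+1} ⋯ g_{n+p})^∞`,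
then `x : ℤ → ℕ` belongs to `X_β` iff `x` admits a presentation in `F_β`. -/
theorem statement6 (β : ℝ) (hβ : 1 < β) (n p : ℕ) (hp : 1 ≤ p)
    (hper : ∀ k, n ≤ k → genSeq β (k + p) = genSeq β k)
    (hmin : ∀ n' p' : ℕ, 1 ≤ p' →
      (∀ k, n' ≤ k → genSeq β (k + p') = genSeq β k) → n ≤ n' ∧ p ≤ p')
    (x : ℤ → ℕ) :
    memBeta β x ↔
      ∃ v : ℤ → ℕ, ∀ i : ℤ, fischerEdge (genSeq β) n p (x i) (v i) (v (i + 1)) := by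
  constructor
  · intro hx
    refine exists_fischerPath_int fun N => exists_fischerPath (y := fun i => x (-N + i)) hp hper
      fun k => ?_
    simpa only [Nat.cast_add, add_assoc] using hx (-N + k)
  · rintro ⟨v, hv⟩ k
    have hpath := lexLe_of_fischerPath hper (y := fun i : ℕ => x (k + i))
      (v := fun i : ℕ => v (k + i)) fun i => by
        simpa only [Nat.cast_add, Nat.cast_one, add_assoc] using hv (k + i)
    exact lexLe_trans hpath (genSeq_shift_le hβ _)
end
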